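/- arXiv:1712.03160 — 2 statements merged into one kernel-verified Lean document; each statement's English description precedes it below -/
import Mathlib

section
/- Let n ≥ 2, let G = [g_jk] ∈ ℝ^{n×n} be symmetric with g_jk ≥ 0 for all j ≠ k and with g_jj = −Σ_{k≠j} g_jk, let G_0 = G − diag(G), assume e^T G_0 e > 0, and set b = 1 and c = (n/(n−1)) e^T G_0 e. Then for all θ ∈ ℝ^n the generalized order parameter ξ(θ) = (1/c) Σ_{j,k=1}^n g_jk cos(θ_k − θ_j) + 1 satisfies −1 + 2/n ≤ ξ(θ) ≤ 1; in particular |ξ(θ)| ≤ 1. -/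
/-- For a matrix with zero row sums, a row sum weighted by phase cosines only sees the
off-diagonal entries, with weights `cos (θ k - θ j) - 1`. -/
lemma sum_mul_cos_eq_sum_offDiag {ι : Type*} [Fintype ι] [DecidableEq ι]
    {G G₀ : Matrix ι ι ℝ} (hdiag : ∀ j, G j j = -∑ k ∈ Finset.univ.erase j, G j k)
    (hG₀ : ∀ j k, G₀ j k = if j = k then 0 else G j k) (θ : ι → ℝ) (j : ι) :
    ∑ k, G j k * Real.cos (θ k - θ j) = ∑ k, G₀ j k * (Real.cos (θ k - θ j) - 1) := by
  have hmem := Finset.mem_univ j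
  rw [← Finset.add_sum_erase _ _ hmem, ← Finset.add_sum_erase _ _ hmem, hdiag j, hG₀ j j,
    if_pos rfl, sub_self, Real.cos_zero, mul_one, zero_mul, zero_add, neg_add_eq_sub,
    ← Finset.sum_sub_distrib]
  refine Finset.sum_congr rfl fun k hk => ?_
  rw [hG₀, if_neg (Finset.ne_of_mem_erase hk).symm]
  ring

/-- with b = 1, c = (n/(n−1)) eᵀG₀e > 0 and zero row sums,
the generalized order parameter satisfies −1 + 2/n ≤ ξ(θ) ≤ 1, in particular |ξ(θ)| ≤ 1. -/
theorem xi_bounds (n : ℕ) (hn : 2 ≤ n) (G : Matrix (Fin n) (Fin n) ℝ)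
    (hsym : G.IsSymm) (hoff : ∀ j k, j ≠ k → 0 ≤ G j k)
    (hdiag : ∀ j, G j j = -∑ k ∈ Finset.univ.erase j, G j k)
    (G₀ : Matrix (Fin n) (Fin n) ℝ)
    (hG₀ : ∀ j k, G₀ j k = if j = k then 0 else G j k)
    (hpos : 0 < ∑ j, ∑ k, G₀ j k)
    (c : ℝ) (hc : c = ((n : ℝ) / ((n : ℝ) - 1)) * ∑ j, ∑ k, G₀ j k)
    (θ : Fin n → ℝ) (ξ : ℝ)
    (hξ : ξ = (1 / c) * (∑ j, ∑ k, G j k * Real.cos (θ k - θ j)) + 1) :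
    (-1 + 2 / (n : ℝ) ≤ ξ ∧ ξ ≤ 1) ∧ |ξ| ≤ 1 := by
  have hnonneg : ∀ j k, 0 ≤ G₀ j k := fun j k => by
    rw [hG₀]
    split_ifs with h
    exacts [le_rfl, hoff j k h]
  simp_rw [sum_mul_cos_eq_sum_offDiag hdiag hG₀ θ] at hξ
  set S := ∑ j, ∑ k, G₀ j k
  set T := ∑ j, ∑ k, G₀ j k * (Real.cos (θ k - θ j) - 1)
  have hT_nonpos : T ≤ 0 :=
    Finset.sum_nonpos fun j _ => Finset.sum_nonpos fun k _ =>
      mul_nonpos_of_nonneg_of_nonpos (hnonneg j k) (by linarith [Real.cos_le_one (θ k - θ j)])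
  have hT_lower : -2 * S ≤ T := by
    simp only [S, T, Finset.mul_sum]
    refine Finset.sum_le_sum fun j _ => Finset.sum_le_sum fun k _ => ?_
    nlinarith [hnonneg j k, Real.neg_one_le_cos (θ k - θ j)]
  have hn' : (2 : ℝ) ≤ n := by exact_mod_cast hn
  have hn_pos : (0 : ℝ) < n := by linarith
  have hn_sub_pos : (0 : ℝ) < n - 1 := by linarith
  have hc_pos : 0 < c := by rw [hc]; positivity
  have hupper : ξ ≤ 1 := by
    have := mul_nonpos_of_nonneg_of_nonpos (one_div_pos.mpr hc_pos).le hT_nonpos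
    linarith
  have hlower : -1 + 2 / (n : ℝ) ≤ ξ := by
    have h := mul_le_mul_of_nonneg_left hT_lower (one_div_pos.mpr hc_pos).le
    have hval : 1 / c * (-2 * S) = -2 + 2 / (n : ℝ) := by
      rw [hc]
      field_simp
      ring
    linarith
  have : 0 < 2 / (n : ℝ) := by positivity
  exact ⟨⟨hlower, hupper⟩, abs_le.mpr ⟨by linarith, hupper⟩⟩
end

section
/- Let M = diag(m_j) with m_j > 0, D = diag(d_j) with d_j ≥ 0, Ω ∈ ℝ^n, K > 0, and G = K e e^T where e ∈ ℝ^n is the all-ones vector. Suppose ω, ρ, σ : I → ℝ^n are differentiable on an interval I and satisfy the pHDAE system M ω' = Ω − D ω − D_σ G ρ + D_ρ G σ, ρ' = −D_σ ω, σ' = D_ρ ω (with D_ρ = diag(ρ_j), D_σ = diag(σ_j)). Then the Hamiltonian H(t) = (1/2) ω(t)^T M ω(t) − (1/2) ρ(t)^T G ρ(t) − (1/2) σ(t)^T G σ(t) is differentiable with H'(t) = −ω(t)^T D ω(t) + ω(t)^T Ω ≤ ω(t)^T Ω, i.e., the system satisfies the port-Hamiltonian dissipation identity with input u = Ω and output y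 = ω. -/
/-- The quadratic form of the rank-one coupling matrix `K e eᵀ` along a differentiable curve `x`
has half-derivative `x'ᵀ (K e eᵀ) x`. -/
theorem hasDerivWithinAt_half_rankOne_quadratic {ι : Type*} [Fintype ι] {I : Set ℝ} {t : ℝ} (K : ℝ)
    {x : ℝ → ι → ℝ} {x' : ι → ℝ} (hx : ∀ j, HasDerivWithinAt (fun s => x s j) (x' j) I t) :
    HasDerivWithinAt (fun s => (1 / 2) * ∑ j, x s j * ∑ k, K * x s k)
      ((∑ j, x' j) * ∑ k, K * x t k) I t := by
  have hsum : HasDerivWithinAt (fun s => ∑ j, x s j) (∑ j, x' j) I t :=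
    HasDerivWithinAt.fun_sum fun j _ => hx j
  simp only [← Finset.mul_sum, ← Finset.sum_mul]
  refine ((hsum.fun_mul (hsum.const_mul K)).const_mul (1 / 2)).congr_deriv ?_
  ring

/-- The derivative of the kinetic energy with diagonal mass matrix. -/
theorem hasDerivWithinAt_half_diagonal_quadratic {ι : Type*} [Fintype ι] {I : Set ℝ} {t : ℝ}
    (m : ι → ℝ) {x : ℝ → ι → ℝ} {x' : ι → ℝ}
    (hx : ∀ j, HasDerivWithinAt (fun s => x s j) (x' j) I t) :
    HasDerivWithinAt (fun s => (1 / 2) * ∑ j, m j * x s j ^ 2)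
      (∑ j, x t j * (m j * x' j)) I t := by
  refine ((HasDerivWithinAt.fun_sum fun j _ =>
    ((hx j).fun_pow 2).const_mul (m j)).const_mul (1 / 2)).congr_deriv ?_
  rw [Finset.mul_sum]
  refine Finset.sum_congr rfl fun j _ => ?_
  norm_num
  ring

/-- along any solution of the pHDAE formulation of the standard
Kuramoto model M ω' = Ω − D ω − D_σ G ρ + D_ρ G σ, ρ' = −D_σ ω, σ' = D_ρ ω with
G = K e eᵀ, the Hamiltonian H = (1/2)ωᵀMω − (1/2)ρᵀGρ − (1/2)σᵀGσ satisfies the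
port-Hamiltonian dissipation identity H' = −ωᵀDω + ωᵀΩ ≤ ωᵀΩ. -/
theorem pHDAE_dissipation_identity (n : ℕ) (I : Set ℝ) (hI : Convex ℝ I)
    (m d Ω : Fin n → ℝ) (hm : ∀ j, 0 < m j) (hd : ∀ j, 0 ≤ d j)
    (K : ℝ) (hK : 0 < K)
    (ω ρ σ α : ℝ → Fin n → ℝ)
    (hω : ∀ j, ∀ t ∈ I, HasDerivWithinAt (fun s => ω s j) (α t j) I t)
    (heq : ∀ j, ∀ t ∈ I,
      m j * α t j = Ω j - d j * ω t j
        - σ t j * (∑ k, K * ρ t k) + ρ t j * (∑ k, K * σ t k))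
    (hρ : ∀ j, ∀ t ∈ I, HasDerivWithinAt (fun s => ρ s j) (-(σ t j * ω t j)) I t)
    (hσ : ∀ j, ∀ t ∈ I, HasDerivWithinAt (fun s => σ s j) (ρ t j * ω t j) I t)
    (H : ℝ → ℝ)
    (hH : ∀ t, H t = (1 / 2) * ∑ j, m j * ω t j ^ 2
        - (1 / 2) * ∑ j, ρ t j * ∑ k, K * ρ t k
        - (1 / 2) * ∑ j, σ t j * ∑ k, K * σ t k) :
    ∀ t ∈ I,
      HasDerivWithinAt H (-(∑ j, d j * ω t j ^ 2) + ∑ j, ω t j * Ω j) I t ∧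
      -(∑ j, d j * ω t j ^ 2) + ∑ j, ω t j * Ω j ≤ ∑ j, ω t j * Ω j := by
  intro t ht
  refine ⟨?_, ?_⟩
  · rw [funext hH]
    refine (((hasDerivWithinAt_half_diagonal_quadratic m fun j => hω j t ht).fun_sub
      (hasDerivWithinAt_half_rankOne_quadratic K fun j => hρ j t ht)).fun_sub
      (hasDerivWithinAt_half_rankOne_quadratic K fun j => hσ j t ht)).congr_deriv ?_
    rw [Finset.sum_mul, Finset.sum_mul, ← Finset.sum_sub_distrib, ← Finset.sum_sub_distrib,
      ← Finset.sum_neg_distrib, ← Finset.sum_add_distrib]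
    refine Finset.sum_congr rfl fun j _ => ?_
    rw [heq j t ht]
    ring
  · have hdiss : 0 ≤ ∑ j, d j * ω t j ^ 2 :=
      Finset.sum_nonneg fun j _ => mul_nonneg (hd j) (sq_nonneg _)
    linarith
end
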